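/- Let T1 and T2 be mixed tableaux, each α-column-strict, β-row-strict, and (α,β)-sorted. If some fully switched tableau X is obtained from both T1 and T2 by sequences of switches, then T1 = T2. -/

import Mathlib

/-!
Common definitions: mixed tableaux, tableau switching, shuffling, GG-jdt,
hook-valued tableaux and the uncrowding algorithms.
Conventions: French notation, cells `(i, j)` with `i` the row index (counted
from the bottom) and `j` the column index, both `≥ 1`.
-/

open scoped Classical

abbrev Cell : Type := ℕ × ℕ

/-- The cell directly above `c`. -/
def upCell (c : Cell) : Cell := (c.1 + 1, c.2)

/-- The cell directly to the right of `c`. -/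
def rtCell (c : Cell) : Cell := (c.1, c.2 + 1)

/-- A (finite) partition shape: a finite lower-order ideal of cells in the
positive quadrant (1-indexed, French notation). -/
def IsPartitionShape (s : Set Cell) : Prop :=
  s.Finite ∧ (∀ c ∈ s, 1 ≤ c.1 ∧ 1 ≤ c.2) ∧
    ∀ i j i' j' : ℕ, (i, j) ∈ s → 1 ≤ i' → i' ≤ i → 1 ≤ j' → j' ≤ j → (i', j') ∈ s

/-- Entries of mixed tableaux: `al k` represents `α_k`, `be k` represents `β_k`. -/
inductive MEntry : Type
  | al (k : ℤ)
  | be (k : ℤ)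
  deriving DecidableEq

/-- The index of a mixed entry. -/
def MEntry.idx : MEntry → ℤ
  | .al k => k
  | .be k => k

def MEntry.isAlpha : MEntry → Prop
  | .al _ => True
  | .be _ => False

def MEntry.isBeta : MEntry → Prop
  | .al _ => False
  | .be _ => True

/-- A mixed tableau: a partial filling of cells with mixed entries. -/
abbrev MixedTableau : Type := Cell → Option MEntry

/-- The set of cells filled in a mixed tableau. -/
def mshape (T : MixedTableau) : Set Cell := {c | T c ≠ none}

/-- A legal mixed tableau: finitely many cells, all in the positive quadrant,
and indices of `α` entries are positive. -/
def IsMixedTableau (T : MixedTableau) : Prop :=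
  (mshape T).Finite ∧ (∀ c ∈ mshape T, 1 ≤ c.1 ∧ 1 ≤ c.2) ∧
    ∀ c k, T c = some (MEntry.al k) → 0 < k

/-- `T` is a filling of the skew shape `mu / lam`. -/
def HasSkewShape (T : MixedTableau) (lam mu : Set Cell) : Prop :=
  IsPartitionShape lam ∧ IsPartitionShape mu ∧ lam ⊆ mu ∧ mshape T = mu \ lam

/-- `γ`-column-strictness for the entries selected by `p`:
indices weakly decrease to the northeast, and no two selected entries in the
same column have equal indices. -/
def ColumnStrictFor (p : MEntry → Prop) (T : MixedTableau) : Prop :=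
  (∀ c c' e e', T c = some e → T c' = some e' → p e → p e' →
      c.1 ≤ c'.1 → c.2 ≤ c'.2 → MEntry.idx e' ≤ MEntry.idx e) ∧
  (∀ c c' e e', T c = some e → T c' = some e' → p e → p e' →
      c.2 = c'.2 → c ≠ c' → MEntry.idx e ≠ MEntry.idx e')

/-- `γ`-row-strictness for the entries selected by `p`. -/
def RowStrictFor (p : MEntry → Prop) (T : MixedTableau) : Prop :=
  (∀ c c' e e', T c = some e → T c' = some e' → p e → p e' →
      c.1 ≤ c'.1 → c.2 ≤ c'.2 → MEntry.idx e' ≤ MEntry.idx e) ∧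
  (∀ c c' e e', T c = some e → T c' = some e' → p e → p e' →
      c.1 = c'.1 → c ≠ c' → MEntry.idx e ≠ MEntry.idx e')

def AlphaColumnStrict (T : MixedTableau) : Prop := ColumnStrictFor MEntry.isAlpha T
def AlphaRowStrict (T : MixedTableau) : Prop := RowStrictFor MEntry.isAlpha T
def BetaColumnStrict (T : MixedTableau) : Prop := ColumnStrictFor MEntry.isBeta T
def BetaRowStrict (T : MixedTableau) : Prop := RowStrictFor MEntry.isBeta T

def alphaCells (T : MixedTableau) : Set Cell := {c | ∃ k, T c = some (MEntry.al k)}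
def betaCells (T : MixedTableau) : Set Cell := {c | ∃ k, T c = some (MEntry.be k)}

/-- `(α,β)`-sortedness relative to the skew shape `mu / lam`: the `α`-cells form
`nu / lam` and the `β`-cells form `mu / nu` for some partition `nu`. -/
def ABSortedShape (T : MixedTableau) (lam mu : Set Cell) : Prop :=
  ∃ nu : Set Cell, IsPartitionShape nu ∧ lam ⊆ nu ∧ nu ⊆ mu ∧
    alphaCells T = nu \ lam ∧ betaCells T = mu \ nu

/-- `(α,β)`-sorted. -/
def ABSorted (T : MixedTableau) : Prop :=
  ∃ lam mu : Set Cell, HasSkewShape T lam mu ∧ ABSortedShape T lam mu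

/-- `(β,α)`-sortedness relative to the skew shape `mu / lam`. -/
def BASortedShape (T : MixedTableau) (lam mu : Set Cell) : Prop :=
  ∃ nu : Set Cell, IsPartitionShape nu ∧ lam ⊆ nu ∧ nu ⊆ mu ∧
    betaCells T = nu \ lam ∧ alphaCells T = mu \ nu

/-- `(β,α)`-sorted. -/
def BASorted (T : MixedTableau) : Prop :=
  ∃ lam mu : Set Cell, HasSkewShape T lam mu ∧ BASortedShape T lam mu

/-- Interchange the contents of two cells. -/
def swapCells (T : MixedTableau) (c c' : Cell) : MixedTableau :=
  Function.update (Function.update T c (T c')) c' (T c)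

/-- A switch: interchange an `α_r` with a `β_s` directly to its right or
directly above it, provided both the source and the result are
`α`-column-strict and `β`-row-strict. -/
def Switch (T T' : MixedTableau) : Prop :=
  AlphaColumnStrict T ∧ BetaRowStrict T ∧
  ∃ c c' : Cell, (c' = rtCell c ∨ c' = upCell c) ∧
    (∃ r, T c = some (MEntry.al r)) ∧ (∃ s, T c' = some (MEntry.be s)) ∧
    T' = swapCells T c c' ∧ AlphaColumnStrict T' ∧ BetaRowStrict T'

/-- Fully switched: no switch is possible. -/
def FullySwitched (T : MixedTableau) : Prop := ¬ ∃ T', Switch T T'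

/-- The cell `c` contains a `β` entry. -/
def isBetaCell (T : MixedTableau) (c : Cell) : Prop := ∃ k, T c = some (MEntry.be k)

/-- One step of the switching process of the shuffle: the `α` entry at `c`
moves to the cell `c'` (above or to the right), following the tie-breaking
rule of the jeu de taquin shuffle. -/
def ShuffMoveTo (Q : MixedTableau) (c c' : Cell) (Q' : MixedTableau) : Prop :=
  (∃ i, Q c = some (MEntry.al i)) ∧ Q' = swapCells Q c c' ∧
  ((isBetaCell Q (rtCell c) ∧ ¬ isBetaCell Q (upCell c) ∧ c' = rtCell c) ∨
   (isBetaCell Q (upCell c) ∧ ¬ isBetaCell Q (rtCell c) ∧ c' = upCell c) ∨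
   (∃ k j, Q (upCell c) = some (MEntry.be k) ∧ Q (rtCell c) = some (MEntry.be j) ∧
      ((j < k ∧ c' = upCell c) ∨ (k ≤ j ∧ c' = rtCell c))))

/-- The `α` entry at `c` is settled: the cells above and to the right of it
contain `α` entries or are empty. -/
def ShuffSettled (Q : MixedTableau) (c : Cell) : Prop :=
  ¬ isBetaCell Q (upCell c) ∧ ¬ isBetaCell Q (rtCell c)

/-- The full switching process of a single chosen `α` entry, starting at cell `c`,
until it is settled. -/
inductive ShuffTrack : MixedTableau → Cell → MixedTableau → Prop
  | done : ∀ Q c, ShuffSettled Q c → ShuffTrack Q c Q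
  | step : ∀ Q c c' Q' R, ShuffMoveTo Q c c' Q' → ShuffTrack Q' c' R → ShuffTrack Q c R

/-- The cell `c` holds an `α` entry having a `β` entry directly above or
directly to its right. -/
def ShuffPending (Q : MixedTableau) (c : Cell) : Prop :=
  (∃ i, Q c = some (MEntry.al i)) ∧ (isBetaCell Q (upCell c) ∨ isBetaCell Q (rtCell c))

/-- Among the pending `α` entries, the rightmost one with the smallest index. -/
def ShuffChosen (Q : MixedTableau) (c : Cell) : Prop :=
  ShuffPending Q c ∧ ∃ i, Q c = some (MEntry.al i) ∧
    (∀ c' i', ShuffPending Q c' → Q c' = some (MEntry.al i') → i ≤ i') ∧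
    (∀ c', ShuffPending Q c' → Q c' = some (MEntry.al i) → c'.2 ≤ c.2)

/-- `ShuffRel Q R` means `R = shuff(Q)`, the jeu de taquin shuffle of `Q`. -/
inductive ShuffRel : MixedTableau → MixedTableau → Prop
  | done : ∀ Q, (∀ c, ¬ ShuffPending Q c) → ShuffRel Q Q
  | step : ∀ Q c Q' R, ShuffChosen Q c → ShuffTrack Q c Q' → ShuffRel Q' R → ShuffRel Q R

/-- The entry `α_r` at `c` is out of order via its right neighbour. -/
def OutOfOrderH (T : MixedTableau) (c : Cell) : Prop :=
  ∃ r s : ℤ, T c = some (MEntry.al r) ∧ T (rtCell c) = some (MEntry.be s) ∧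
    r < s + ((c.2 : ℤ) + 1) - (c.1 : ℤ)

/-- The entry `α_r` at `c` is out of order via its upper neighbour. -/
def OutOfOrderV (T : MixedTableau) (c : Cell) : Prop :=
  ∃ r t : ℤ, T c = some (MEntry.al r) ∧ T (upCell c) = some (MEntry.be t) ∧
    r ≤ t + (c.2 : ℤ) - ((c.1 : ℤ) + 1)

def OutOfOrder (T : MixedTableau) (c : Cell) : Prop := OutOfOrderH T c ∨ OutOfOrderV T c

/-- The GG-jdt slide at the cell `c`. -/
def GGSlide (T : MixedTableau) (c : Cell) (T' : MixedTableau) : Prop :=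
  (OutOfOrderH T c ∧ ¬ OutOfOrderV T c ∧ T' = swapCells T c (rtCell c)) ∨
  (OutOfOrderV T c ∧ ¬ OutOfOrderH T c ∧ T' = swapCells T c (upCell c)) ∨
  (OutOfOrderH T c ∧ OutOfOrderV T c ∧
    ∃ s t : ℤ, T (rtCell c) = some (MEntry.be s) ∧ T (upCell c) = some (MEntry.be t) ∧
      ((t ≤ s ∧ T' = swapCells T c (rtCell c)) ∨ (s < t ∧ T' = swapCells T c (upCell c))))

/-- The cell chosen by the GG-jdt map: the rightmost cell containing an
out-of-order `α_r` with `r` smallest. -/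
def GGChosen (T : MixedTableau) (c : Cell) : Prop :=
  ∃ r : ℤ, T c = some (MEntry.al r) ∧ OutOfOrder T c ∧
    (∀ c' r', T c' = some (MEntry.al r') → OutOfOrder T c' → r ≤ r') ∧
    (∀ c', T c' = some (MEntry.al r) → OutOfOrder T c' → c'.2 ≤ c.2)

/-- One iteration of the GG-jdt map. -/
def GGStep (T T' : MixedTableau) : Prop := ∃ c, GGChosen T c ∧ GGSlide T c T'

/-- `GGRel T R` means `R = jdt_GG(T)`. -/
def GGRel (T R : MixedTableau) : Prop :=
  Relation.ReflTransGen GGStep T R ∧ ∀ c, ¬ OutOfOrder R c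

/-- `c_β^+`: replace each `β_r` in a cell of content `c = j - i` by `β_{r+c}`. -/
def cBetaPlus (T : MixedTableau) : MixedTableau := fun c =>
  match T c with
  | some (MEntry.be r) => some (MEntry.be (r + ((c.2 : ℤ) - (c.1 : ℤ))))
  | o => o

/-- Totally column-strict: indices strictly decrease up columns and weakly
decrease along rows. -/
def TotallyColumnStrict (T : MixedTableau) : Prop :=
  (∀ c e e', T c = some e → T (upCell c) = some e' → MEntry.idx e' < MEntry.idx e) ∧
  (∀ c e e', T c = some e → T (rtCell c) = some e' → MEntry.idx e' ≤ MEntry.idx e)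

/-- Flagged-mixed tableau: `α_k` in column `j` forces `0 < k < j`, and
`β_k` in row `i` forces `0 < k < i`. -/
def IsFMT (T : MixedTableau) : Prop :=
  (∀ c k, T c = some (MEntry.al k) → 0 < k ∧ k < (c.2 : ℤ)) ∧
  (∀ c k, T c = some (MEntry.be k) → 0 < k ∧ k < (c.1 : ℤ))

/-- Exquisite tableau of shape `mu / lam`. -/
def IsEXQ (lam mu : Set Cell) (E : MixedTableau) : Prop :=
  IsMixedTableau E ∧ HasSkewShape E lam mu ∧ IsFMT E ∧
    TotallyColumnStrict (cBetaPlus E)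

/-- Biflagged tableau of shape `mu / lam`. -/
def IsBFT (lam mu : Set Cell) (Q : MixedTableau) : Prop :=
  IsMixedTableau Q ∧ HasSkewShape Q lam mu ∧
  AlphaColumnStrict Q ∧ BetaRowStrict Q ∧ ABSortedShape Q lam mu ∧
  IsFMT Q ∧ (∃ R, ShuffRel Q R) ∧ (∀ R, ShuffRel Q R → IsFMT R)

/-- Number of occurrences of the entry `e` in the mixed tableau `Q`:
the exponent of the corresponding variable in `wt(Q)`. -/
noncomputable def mcount (Q : MixedTableau) (e : MEntry) : ℕ :=
  Set.ncard {c | Q c = some e}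

/-! ### Hook-valued tableaux -/

/-- A hook: a hook entry, a list of leg entries and a list of arm entries. -/
structure Hook : Type where
  hk : ℕ
  legs : List ℕ
  arms : List ℕ
  deriving DecidableEq

/-- Valid hook: positive entries, `hk < L₁ < ⋯ < L_ℓ` and `hk ≤ A₁ ≤ ⋯ ≤ A_k`. -/
def Hook.Valid (H : Hook) : Prop :=
  1 ≤ H.hk ∧ H.legs.Chain' (· < ·) ∧ (∀ x ∈ H.legs, H.hk < x) ∧
  H.arms.Chain' (· ≤ ·) ∧ ∀ x ∈ H.arms, H.hk ≤ x

/-- The multiset of all entries of a hook. -/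
def Hook.entries (H : Hook) : Multiset ℕ :=
  H.hk ::ₘ ((H.legs : Multiset ℕ) + (H.arms : Multiset ℕ))

/-- A hook-valued filling. -/
abbrev HVTab : Type := Cell → Option Hook

def hshape (T : HVTab) : Set Cell := {c | T c ≠ none}

noncomputable def hsize (T : HVTab) : ℕ := (hshape T).ncard

def hentriesAt (T : HVTab) (c : Cell) : Multiset ℕ :=
  match T c with
  | some H => H.entries
  | none => 0

def armsAt (T : HVTab) (c : Cell) : List ℕ :=
  match T c with
  | some H => H.arms
  | none => []

def legsAt (T : HVTab) (c : Cell) : List ℕ :=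
  match T c with
  | some H => H.legs
  | none => []

/-- Hook-valued tableau: partition shape, valid hooks, rows weakly increasing
(entrywise) and columns strictly increasing (entrywise). -/
def IsHVT (T : HVTab) : Prop :=
  IsPartitionShape (hshape T) ∧
  (∀ c H, T c = some H → H.Valid) ∧
  (∀ c, ∀ x ∈ hentriesAt T c, ∀ y ∈ hentriesAt T (rtCell c), x ≤ y) ∧
  (∀ c, ∀ x ∈ hentriesAt T c, ∀ y ∈ hentriesAt T (upCell c), x < y)

def NoArms (T : HVTab) : Prop := ∀ c, armsAt T c = []
def NoLegs (T : HVTab) : Prop := ∀ c, legsAt T c = []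

/-- Insert into a sorted list. -/
def insSorted (x : ℕ) : List ℕ → List ℕ
  | [] => [x]
  | y :: ys => if x ≤ y then x :: y :: ys else y :: insSorted x ys

def insSortedAll (xs : List ℕ) (l : List ℕ) : List ℕ :=
  xs.foldl (fun acc x => insSorted x acc) l

/-- In arm-uncrowding, the receiving cell's hook: replace its entry `k`
(the smallest entry `≥ a`) by `a` and insert `k` as an arm entry. -/
def Hook.receiveArm (H : Hook) (a k : ℕ) : Hook :=
  if H.hk = k then ⟨a, H.legs, insSorted k H.arms⟩
  else if k ∈ H.legs then ⟨H.hk, insSorted a (H.legs.erase k), insSorted k H.arms⟩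
  else ⟨H.hk, H.legs, insSorted a H.arms⟩

/-- In leg-uncrowding, the receiving cell's hook: replace its entry `k`
(the smallest entry `> l`) by `l` and insert `k` as a leg entry. -/
def Hook.receiveLeg (H : Hook) (l k : ℕ) : Hook :=
  if H.hk = k then ⟨l, insSorted k H.legs, H.arms⟩
  else if k ∈ H.legs then ⟨H.hk, insSorted l H.legs, H.arms⟩
  else ⟨H.hk, insSorted k H.legs, insSorted l (H.arms.erase k)⟩

/-- Add the arm entries `xs` to the cell `c` of `T`. -/
def addArmsAt (T : HVTab) (c : Cell) (xs : List ℕ) : HVTab :=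
  if xs = [] then T
  else
    match T c with
    | some H => Function.update T c (some ⟨H.hk, H.legs, insSortedAll xs H.arms⟩)
    | none => Function.update T c (some ⟨xs.headI, [], xs.tail⟩)

/-- The arm entry selected by arm-uncrowding: `a` is the largest arm entry in
the rightmost column `c` containing an arm entry, located in cell `(r, c)`. -/
def SelectedArm (T : HVTab) (r c a : ℕ) : Prop :=
  a ∈ armsAt T (r, c) ∧
  (∀ r' x, x ∈ armsAt T (r', c) → x ≤ a) ∧
  (∀ r' c', c < c' → armsAt T (r', c') = [])

/-- The leg entry selected by leg-uncrowding: `l` is the largest leg entry in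
the topmost row `r` containing a leg entry, located in cell `(r, c)`. -/
def SelectedLeg (T : HVTab) (r c l : ℕ) : Prop :=
  l ∈ legsAt T (r, c) ∧
  (∀ c' x, x ∈ legsAt T (r, c') → x ≤ l) ∧
  (∀ r' c', r < r' → legsAt T (r', c') = [])

/-- `k` is the smallest entry `≥ a` in column `col`, located in row `rr`. -/
def SmallestGE (T : HVTab) (col a k rr : ℕ) : Prop :=
  k ∈ hentriesAt T (rr, col) ∧ a ≤ k ∧
  ∀ r' y, y ∈ hentriesAt T (r', col) → a ≤ y → k ≤ y

/-- `k` is the smallest entry `> l` in row `row`, located in column `cc`. -/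
def SmallestGT (T : HVTab) (row l k cc : ℕ) : Prop :=
  k ∈ hentriesAt T (row, cc) ∧ l < k ∧
  ∀ c' y, y ∈ hentriesAt T (row, c') → l < y → k ≤ y

/-- The arm-uncrowding bumping `A_b`. -/
def ArmBumpRel (T T' : HVTab) : Prop :=
  (NoArms T ∧ T' = T) ∨
  (∃ r c a H, T (r, c) = some H ∧ SelectedArm T r c a ∧
    ((∃ k rr HT, SmallestGE T (c + 1) a k rr ∧ T (rr, c + 1) = some HT ∧
        ((rr ≠ r ∧
            T' = Function.update (Function.update T (r, c)
                (some ⟨H.hk, H.legs, H.arms.erase a⟩)) (rr, c + 1)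
                (some (Hook.receiveArm HT a k))) ∨
         (rr = r ∧
            T' = Function.update (Function.update T (r, c)
                (some ⟨H.hk, H.legs.filter (fun x => decide (x ≤ a)), H.arms.erase a⟩))
                (r, c + 1)
                (some ⟨(Hook.receiveArm HT a k).hk,
                       insSortedAll (H.legs.filter (fun x => decide (a < x)))
                         (Hook.receiveArm HT a k).legs,
                       (Hook.receiveArm HT a k).arms⟩)))) ∨
     ((∀ r' y, y ∈ hentriesAt T (r', c + 1) → y < a) ∧
        ∃ t, 1 ≤ t ∧ (∀ r', (r', c + 1) ∈ hshape T ↔ 1 ≤ r' ∧ r' < t) ∧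
        ((t ≠ r ∧
            T' = Function.update (Function.update T (r, c)
                (some ⟨H.hk, H.legs, H.arms.erase a⟩)) (t, c + 1)
                (some ⟨a, [], []⟩)) ∨
         (t = r ∧
            T' = Function.update (Function.update T (r, c)
                (some ⟨H.hk, H.legs.filter (fun x => decide (x ≤ a)), H.arms.erase a⟩))
                (r, c + 1)
                (some ⟨a, H.legs.filter (fun x => decide (a < x)), []⟩))))))

/-- The leg-uncrowding bumping `L_b`. -/
def LegBumpRel (T T' : HVTab) : Prop :=
  (NoLegs T ∧ T' = T) ∨
  (∃ r c l H, T (r, c) = some H ∧ SelectedLeg T r c l ∧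
    ((∃ k cc HT, SmallestGT T (r + 1) l k cc ∧ T (r + 1, cc) = some HT ∧
        ((cc ≠ c ∧
            T' = Function.update (Function.update T (r, c)
                (some ⟨H.hk, H.legs.erase l, H.arms⟩)) (r + 1, cc)
                (some (Hook.receiveLeg HT l k))) ∨
         (cc = c ∧
            T' = addArmsAt
              (Function.update (Function.update T (r, c)
                  (some ⟨H.hk, H.legs.erase l, H.arms.filter (fun x => decide (l < x))⟩))
                  (r + 1, c) (some (Hook.receiveLeg HT l k)))
              (r, c + 1) (H.arms.filter (fun x => decide (x ≤ l)))))) ∨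
     ((∀ c' y, y ∈ hentriesAt T (r + 1, c') → y ≤ l) ∧
        ∃ t, 1 ≤ t ∧ (∀ c', (r + 1, c') ∈ hshape T ↔ 1 ≤ c' ∧ c' < t) ∧
        ((t ≠ c ∧
            T' = Function.update (Function.update T (r, c)
                (some ⟨H.hk, H.legs.erase l, H.arms⟩)) (r + 1, t)
                (some ⟨l, [], []⟩)) ∨
         (t = c ∧
            T' = Function.update (Function.update T (r, c)
                (some ⟨H.hk, H.legs.erase l, H.arms.filter (fun x => decide (l < x))⟩))
                (r + 1, c)
                (some ⟨l, [], H.arms.filter (fun x => decide (x ≤ l))⟩))))))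

/-- `n`-fold composition of a relation. -/
def RelPow {α : Type*} (R : α → α → Prop) : ℕ → α → α → Prop
  | 0, a, b => a = b
  | n + 1, a, b => ∃ x, R a x ∧ RelPow R n x b

/-- The single-arm-uncrowding map `𝒜`. -/
def ArmRel (T T' : HVTab) : Prop :=
  (NoArms T ∧ T' = T) ∨
  (¬ NoArms T ∧ ∃ m : ℕ, RelPow ArmBumpRel m T T' ∧ hsize T' = hsize T + 1 ∧
    ∀ m' U, m' < m → RelPow ArmBumpRel m' T U → hsize U = hsize T)

/-- The single-leg-uncrowding map `ℒ`. -/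
def LegRel (T T' : HVTab) : Prop :=
  (NoLegs T ∧ T' = T) ∨
  (¬ NoLegs T ∧ ∃ m : ℕ, RelPow LegBumpRel m T T' ∧ hsize T' = hsize T + 1 ∧
    ∀ m' U, m' < m → RelPow LegBumpRel m' T U → hsize U = hsize T)

/-- The two kinds of uncrowding operators. -/
inductive Bump : Type
  | A
  | L
  deriving DecidableEq

def BumpRel : Bump → HVTab → HVTab → Prop
  | .A => ArmBumpRel
  | .L => LegBumpRel

/-- `T` has type `f_k^{(ε_k)} ⋯ f_1^{(ε_1)}`; the word is given as the list
`[(f_1, ε_1), …, (f_k, ε_k)]` in order of application. -/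
def HasType : HVTab → List (Bump × ℕ) → Prop
  | _, [] => True
  | T, (f, e) :: w => ∃ T', BumpRel f T T' ∧ hsize T' = hsize T + e ∧ HasType T' w

def StepRel : Bump → HVTab → HVTab → Prop
  | .A => ArmRel
  | .L => LegRel

def SelectedArmCol (T : HVTab) (c : ℕ) : Prop := ∃ r a, SelectedArm T r c a
def SelectedLegRow (T : HVTab) (r : ℕ) : Prop := ∃ c l, SelectedLeg T r c l

/-- The recorded entry of one uncrowding step applied to `T`. -/
def StepEntry : Bump → HVTab → MEntry → Prop
  | .A, T, e => ∃ c : ℕ, SelectedArmCol T c ∧ e = MEntry.al (c : ℤ)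
  | .L, T, e => ∃ r : ℕ, SelectedLegRow T r ∧ e = MEntry.be (r : ℤ)

/-- `UncrowdRec w T P Q` means `𝒰_w(T) = (P, Q)`, where `w` is the word listed
in order of application. -/
def UncrowdRec : List Bump → HVTab → HVTab → MixedTableau → Prop
  | [], T, P, Q => P = T ∧ ∀ c, Q c = none
  | f :: w, T, P, Q => ∃ T' Q', StepRel f T T' ∧ UncrowdRec w T' P Q' ∧
      (∀ cell, cell ∈ hshape T' → cell ∉ hshape T →
        ∃ e, StepEntry f T e ∧ Q cell = some e) ∧
      (∀ cell, ¬ (cell ∈ hshape T' ∧ cell ∉ hshape T) → Q cell = Q' cell)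

/-- `𝒰_{ℒ^∞𝒜^∞}(T) = (P, Q)`. -/
def UncrowdLAinf (T P : HVTab) (Q : MixedTableau) : Prop :=
  ∃ M N : ℕ, UncrowdRec (List.replicate M Bump.A ++ List.replicate N Bump.L) T P Q ∧
    NoArms P ∧ NoLegs P

/-- `𝒰_{𝒜^∞ℒ^∞}(T) = (P, Q)`. -/
def UncrowdALinf (T P : HVTab) (Q : MixedTableau) : Prop :=
  ∃ M N : ℕ, UncrowdRec (List.replicate N Bump.L ++ List.replicate M Bump.A) T P Q ∧
    NoArms P ∧ NoLegs P

/-- A semistandard Young tableau, seen as a hook-valued tableau all of whose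
hooks have no arm and no leg entries. -/
def IsSSYT (P : HVTab) : Prop := IsHVT P ∧ NoArms P ∧ NoLegs P

/-- Number of arm entries in column `j` of `T`: the exponent of `α_j` in `wt(T)`. -/
noncomputable def armCountCol (T : HVTab) (j : ℕ) : ℕ := ∑ᶠ i : ℕ, (armsAt T (i, j)).length

/-- Number of leg entries in row `i` of `T`: the exponent of `β_i` in `wt(T)`. -/
noncomputable def legCountRow (T : HVTab) (i : ℕ) : ℕ := ∑ᶠ j : ℕ, (legsAt T (i, j)).length

/-- Number of entries of `T` equal to `v`: the exponent of `x_v` in `wt(T)`. -/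
noncomputable def entryCount (T : HVTab) (v : ℕ) : ℕ := ∑ᶠ c : Cell, (hentriesAt T c).count v

noncomputable def armCountColZ (T : HVTab) (k : ℤ) : ℕ :=
  if 0 ≤ k then armCountCol T k.toNat else 0

noncomputable def legCountRowZ (T : HVTab) (k : ℤ) : ℕ :=
  if 0 ≤ k then legCountRow T k.toNat else 0

/-- `wt(T) = wt(P) · wt(Q)` for a hook-valued tableau `T`, a semistandard
Young tableau `P` (as a hook-valued tableau) and a mixed tableau `Q`. -/
def WtEq (T P : HVTab) (Q : MixedTableau) : Prop :=
  (∀ j : ℕ, armCountCol T j = mcount Q (MEntry.al (j : ℤ))) ∧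
  (∀ i : ℕ, legCountRow T i = mcount Q (MEntry.be (i : ℤ))) ∧
  (∀ k : ℤ, k ≤ 0 → mcount Q (MEntry.al k) = 0 ∧ mcount Q (MEntry.be k) = 0) ∧
  (∀ v : ℕ, entryCount T v = entryCount P v)

/-- Compatibility of two cells holding indices `k` and `l`: indices weakly decrease to the
northeast, and differ on distinct cells of the same `f`-line. -/
def Compat (f : Cell → ℕ) (x : Cell) (k : ℤ) (y : Cell) (l : ℤ) : Prop :=
  (x.1 ≤ y.1 → x.2 ≤ y.2 → l ≤ k) ∧ (f x = f y → x ≠ y → k ≠ l)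

/-- All pairs of entries of the form `g k` in `T` are compatible. -/
def PairwiseCompat (f : Cell → ℕ) (g : ℤ → MEntry) (T : MixedTableau) : Prop :=
  ∀ x y k l, T x = some (g k) → T y = some (g l) → Compat f x k y l

theorem alphaColumnStrict_iff (T : MixedTableau) :
    AlphaColumnStrict T ↔ PairwiseCompat Prod.snd MEntry.al T := by
  constructor
  · rintro ⟨h1, h2⟩ x y k l hx hy
    exact ⟨h1 x y _ _ hx hy trivial trivial, h2 x y _ _ hx hy trivial trivial⟩
  · intro h
    constructor <;> rintro x y (k | k) (l | l) hx hy hp hq <;>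
      first | exact hp.elim | exact hq.elim | skip
    · exact (h x y k l hx hy).1
    · exact (h x y k l hx hy).2

theorem betaRowStrict_iff (T : MixedTableau) :
    BetaRowStrict T ↔ PairwiseCompat Prod.fst MEntry.be T := by
  constructor
  · rintro ⟨h1, h2⟩ x y k l hx hy
    exact ⟨h1 x y _ _ hx hy trivial trivial, h2 x y _ _ hx hy trivial trivial⟩
  · intro h
    constructor <;> rintro x y (k | k) (l | l) hx hy hp hq <;>
      first | exact hp.elim | exact hq.elim | skip
    · exact (h x y k l hx hy).1
    · exact (h x y k l hx hy).2

theorem swapCells_apply (T : MixedTableau) (c c' x : Cell) :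
    swapCells T c c' x = if x = c' then T c else if x = c then T c' else T x := by
  simp [swapCells, Function.update_apply]

theorem swapCells_swapCells (T : MixedTableau) (c c' : Cell) :
    swapCells (swapCells T c c') c c' = T := by
  funext x
  simp only [swapCells_apply]
  grind

theorem swapCells_comm (T : MixedTableau) {c c' d d' : Cell}
    (h1 : c ≠ d) (h2 : c ≠ d') (h3 : c' ≠ d) (h4 : c' ≠ d') :
    swapCells (swapCells T c c') d d' = swapCells (swapCells T d d') c c' := by
  funext x
  simp only [swapCells_apply]
  grind

theorem Compat.alpha_back {c c' d d' : Cell} {k l : ℤ}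
    (hc : c' = rtCell c ∨ c' = upCell c) (hd : d' = rtCell d ∨ d' = upCell d)
    (hcd : c ≠ d) (hcd' : c ≠ d') (hc'd : c' ≠ d)
    (hX : Compat Prod.snd c' k d' l) (hU : Compat Prod.snd c k d' l)
    (hV : Compat Prod.snd c' k d l) : Compat Prod.snd c k d l := by
  obtain ⟨a, b⟩ := c
  obtain ⟨u, v⟩ := d
  rcases hc with rfl | rfl <;> rcases hd with rfl | rfl <;>
    simp only [Compat, rtCell, upCell, ne_eq, Prod.mk.injEq] at * <;> omega

theorem Compat.beta_forth {c c' d d' : Cell} {k l : ℤ}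
    (hc : c' = rtCell c ∨ c' = upCell c) (hd : d' = rtCell d ∨ d' = upCell d)
    (hcd : c' ≠ d') (hcd' : c ≠ d') (hc'd : c' ≠ d)
    (hX : Compat Prod.fst c k d l) (hU : Compat Prod.fst c' k d l)
    (hV : Compat Prod.fst c k d' l) : Compat Prod.fst c' k d' l := by
  obtain ⟨a, b⟩ := c
  obtain ⟨u, v⟩ := d
  rcases hc with rfl | rfl <;> rcases hd with rfl | rfl <;>
    simp only [Compat, rtCell, upCell, ne_eq, Prod.mk.injEq] at * <;> omega

theorem PairwiseCompat.of_moves {f : Cell → ℕ} {g : ℤ → MEntry}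
    {X U V W : MixedTableau} {c d : Cell} {k l : ℤ}
    (hX : PairwiseCompat f g X) (hU : PairwiseCompat f g U) (hV : PairwiseCompat f g V)
    (hUc : U c = some (g k)) (hVd : V d = some (g l))
    (hW : ∀ x m, W x = some (g m) → (x = c ∧ m = k) ∨ (x = d ∧ m = l) ∨
      (X x = some (g m) ∧ U x = some (g m) ∧ V x = some (g m)))
    (hcd : Compat f c k d l) (hdc : Compat f d l c k) : PairwiseCompat f g W := by
  intro x y m n hx hy
  rcases hW x m hx with ⟨rfl, rfl⟩ | ⟨rfl, rfl⟩ | ⟨hx1, hx2, hx3⟩ <;>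
    rcases hW y n hy with ⟨rfl, rfl⟩ | ⟨rfl, rfl⟩ | ⟨hy1, hy2, hy3⟩
  · exact hU _ _ _ _ hUc hUc
  · exact hcd
  · exact hU _ _ _ _ hUc hy2
  · exact hdc
  · exact hV _ _ _ _ hVd hVd
  · exact hV _ _ _ _ hVd hy3
  · exact hU _ _ _ _ hx2 hUc
  · exact hV _ _ _ _ hx3 hVd
  · exact hX _ _ _ _ hx1 hy1

/-- Reverse switching has the diamond property. -/
theorem Switch.diamond {U V X : MixedTableau} (hU : Switch U X) (hV : Switch V X) (hUV : U ≠ V) :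
    ∃ W, Switch W U ∧ Switch W V := by
  obtain ⟨aU, bU, c, c', hc, ⟨r, hr⟩, ⟨s, hs⟩, hXU, aX, bX⟩ := hU
  obtain ⟨aV, bV, d, d', hd, ⟨q, hq⟩, ⟨t, ht⟩, hXV, -, -⟩ := hV
  have eU : U = swapCells X c c' := by rw [hXU, swapCells_swapCells]
  have eV : V = swapCells X d d' := by rw [hXV, swapCells_swapCells]
  have pU := (alphaColumnStrict_iff U).1 aU
  have pV := (alphaColumnStrict_iff V).1 aV
  have pX := (alphaColumnStrict_iff X).1 aX
  have qU := (betaRowStrict_iff U).1 bU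
  have qV := (betaRowStrict_iff V).1 bV
  have qX := (betaRowStrict_iff X).1 bX
  have ncc : c ≠ c' := by
    rintro rfl; rw [hr] at hs; simp at hs
  have ndd : d ≠ d' := by
    rintro rfl; rw [hq] at ht; simp at ht
  have xc : X c = some (.be s) := by rw [hXU, swapCells_apply]; simp [ncc, hs]
  have xc' : X c' = some (.al r) := by rw [hXU, swapCells_apply]; simp [hr]
  have xd : X d = some (.be t) := by rw [hXV, swapCells_apply]; simp [ndd, ht]
  have xd' : X d' = some (.al q) := by rw [hXV, swapCells_apply]; simp [hq]
  have ncd' : c ≠ d' := by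
    rintro rfl; rw [xc] at xd'; simp at xd'
  have nc'd : c' ≠ d := by
    rintro rfl; rw [xc'] at xd; simp at xd
  have ncd : c ≠ d := by
    rintro rfl
    have hne : c' ≠ d' := by
      rintro rfl; exact hUV (eU.trans eV.symm)
    have h1 := pU c d' r q hr (by rw [eU, swapCells_apply]; simp [hne.symm, ndd.symm, xd'])
    have h2 := pV c c' q r hq (by rw [eV, swapCells_apply]; simp [hne, ncc.symm, xc'])
    obtain ⟨a, b⟩ := c
    rcases hc with rfl | rfl <;> rcases hd with rfl | rfl <;>
      simp [Compat, rtCell, upCell] at h1 h2 hne <;> omega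
  have nc'd' : c' ≠ d' := by
    rintro rfl
    have h1 := qU d c' t s (by rw [eU, swapCells_apply]; simp [ncd.symm, ndd, xd]) hs
    have h2 := qV c c' s t (by rw [eV, swapCells_apply]; simp [ncd, ncc, xc]) ht
    obtain ⟨a, b⟩ := c
    obtain ⟨u, v⟩ := d
    rcases hc with rfl | rfl <;> rcases hd with hd | hd <;>
      simp [Compat, rtCell, upCell] at h1 h2 hd ncd <;> omega
  have ud : U d = some (.be t) := by
    rw [eU, swapCells_apply]; simp [ncd.symm, nc'd.symm, xd]
  have ud' : U d' = some (.al q) := by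
    rw [eU, swapCells_apply]; simp [ncd'.symm, nc'd'.symm, xd']
  have vc : V c = some (.be s) := by
    rw [eV, swapCells_apply]; simp [ncd, ncd', xc]
  have vc' : V c' = some (.al r) := by
    rw [eV, swapCells_apply]; simp [nc'd, nc'd', xc']
  have hWV : swapCells U d d' = swapCells V c c' := by
    rw [eU, eV, swapCells_comm X ncd ncd' nc'd nc'd']
  obtain ⟨W, hW⟩ : ∃ W, W = swapCells U d d' := ⟨_, rfl⟩
  have wx : ∀ x, W x = if x = d' then some (.be t) else if x = d then some (.al q) else
      if x = c' then some (.be s) else if x = c then some (.al r) else X x := by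
    intro x
    rw [hW, swapCells_apply, ud, ud', eU, swapCells_apply, xc, xc']
  have ux : ∀ x, U x = if x = c' then some (.be s) else if x = c then some (.al r) else X x := by
    intro x
    rw [eU, swapCells_apply, xc, xc']
  have vx : ∀ x, V x = if x = d' then some (.be t) else if x = d then some (.al q) else X x := by
    intro x
    rw [eV, swapCells_apply, xd, xd']
  have aW : AlphaColumnStrict W := by
    refine (alphaColumnStrict_iff W).2 (pX.of_moves pU pV hr hq ?_ ?_ ?_)
    · intro x m hx
      rw [wx] at hx
      rw [ux, vx]
      grind
    · exact Compat.alpha_back hc hd ncd ncd' nc'd (pX _ _ _ _ xc' xd') (pU _ _ _ _ hr ud')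
        (pV _ _ _ _ vc' hq)
    · exact Compat.alpha_back hd hc ncd.symm nc'd.symm ncd'.symm (pX _ _ _ _ xd' xc')
        (pV _ _ _ _ hq vc') (pU _ _ _ _ ud' hr)
  have bW : BetaRowStrict W := by
    refine (betaRowStrict_iff W).2 (qX.of_moves qU qV hs ht ?_ ?_ ?_)
    · intro x m hx
      rw [wx] at hx
      rw [ux, vx]
      grind
    · exact Compat.beta_forth hc hd nc'd' ncd' nc'd (qX _ _ _ _ xc xd) (qU _ _ _ _ hs ud)
        (qV _ _ _ _ vc ht)
    · exact Compat.beta_forth hd hc nc'd'.symm nc'd.symm ncd'.symm (qX _ _ _ _ xd xc)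
        (qV _ _ _ _ ht vc) (qU _ _ _ _ ud hs)
  refine ⟨W, ⟨aW, bW, d, d', hd, ⟨q, ?_⟩, ⟨t, ?_⟩, ?_, aU, bU⟩,
    aW, bW, c, c', hc, ⟨r, ?_⟩, ⟨s, ?_⟩, ?_, aV, bV⟩
  · simp [wx, ndd]
  · simp [wx]
  · rw [hW, swapCells_swapCells]
  · simp [wx, ncd, ncd', ncc]
  · simp [wx, nc'd, nc'd']
  · rw [hW, hWV, swapCells_swapCells]

/-- An `(α,β)`-sorted tableau is not the result of a switch. -/
theorem ABSorted.not_switch {T U : MixedTableau} (hs : ABSorted T) : ¬ Switch U T := by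
  rintro ⟨-, -, c, c', hc, ⟨r, hr⟩, ⟨s, hs'⟩, hT, -, -⟩
  obtain ⟨lam, mu, ⟨-, hmu, -, -⟩, nu, hnu, -, -, hα, hβ⟩ := hs
  have ncc : c ≠ c' := by
    rintro rfl; rw [hr] at hs'; simp at hs'
  have h1 : c ∈ mu \ nu := by
    rw [← hβ]; exact ⟨s, by rw [hT, swapCells_apply]; simp [ncc, hs']⟩
  have h2 : c' ∈ nu \ lam := by
    rw [← hα]; exact ⟨r, by rw [hT, swapCells_apply]; simp [hr]⟩
  have hpos := hmu.2.1 c h1.1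
  refine h1.2 (hnu.2.2 c'.1 c'.2 c.1 c.2 h2.1 hpos.1 ?_ hpos.2 ?_) <;>
    rcases hc with rfl | rfl <;> simp [rtCell, upCell]

/-- Corollary 3.8(2): two `α`-column-strict, `β`-row-strict, `(α,β)`-sorted
mixed tableaux switching to the same fully switched tableau are equal. -/
theorem switch_source_unique (T1 T2 X : MixedTableau)
    (hT1 : IsMixedTableau T1) (ha1 : AlphaColumnStrict T1) (hb1 : BetaRowStrict T1)
    (hs1 : ABSorted T1)
    (hT2 : IsMixedTableau T2) (ha2 : AlphaColumnStrict T2) (hb2 : BetaRowStrict T2)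
    (hs2 : ABSorted T2)
    (h1 : Relation.ReflTransGen Switch T1 X) (h2 : Relation.ReflTransGen Switch T2 X)
    (fX : FullySwitched X) :
    T1 = T2 := by
  have key : Relation.Join (Relation.ReflTransGen (Function.swap Switch)) T1 T2 := by
    refine Relation.church_rosser (a := X) ?_ h1.swap h2.swap
    intro X U V hU hV
    by_cases hUV : U = V
    · exact ⟨U, .refl, hUV ▸ .refl⟩
    · obtain ⟨W, hWU, hWV⟩ := Switch.diamond hU hV hUV
      exact ⟨W, .single hWU, .single hWV⟩
  obtain ⟨W, hW1, hW2⟩ := key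
  have e1 := hW1.cases_head.resolve_right fun ⟨_, h, _⟩ => hs1.not_switch h
  have e2 := hW2.cases_head.resolve_right fun ⟨_, h, _⟩ => hs2.not_switch h
  exact e1.trans e2.symm
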